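/- arXiv:2510.01489 — 2 statements merged into one kernel-verified Lean document; each statement's English description precedes it below -/
import Mathlib

section
/- Let l > 0 and let r ∈ ℝ² satisfy ‖r‖ < l, and define 𝔅(r) = B(r)(B(r)ᵀB(r))⁻¹B(r)ᵀ. For every x ∈ ℝ³, writing x_∥ = (ℓ(r)ℓ(r)ᵀ/l²)x and x_⊥ = x − x_∥ for the components of x parallel and perpendicular to ℓ(r), one has xᵀ 𝔅(r) x = x_⊥ᵀ x_⊥. -/
open Matrix

/-- z(r) = √(l² − ‖r‖²). -/
noncomputable def zc (l : ℝ) (r : EuclideanSpace ℝ (Fin 2)) : ℝ :=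
  Real.sqrt (l ^ 2 - ‖r‖ ^ 2)

/-- The cable vector ℓ(r) = (r₁, r₂, z(r)) ∈ ℝ³. -/
noncomputable def cableVec (l : ℝ) (r : EuclideanSpace ℝ (Fin 2)) : Fin 3 → ℝ :=
  ![r 0, r 1, zc l r]

/-- The 3×2 matrix B(r): top block the 2×2 identity, bottom row −rᵀ/z(r). -/
noncomputable def Bmat (l : ℝ) (r : EuclideanSpace ℝ (Fin 2)) : Matrix (Fin 3) (Fin 2) ℝ :=
  Matrix.of ![![1, 0], ![0, 1], ![-(r 0) / zc l r, -(r 1) / zc l r]]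


/-- The auxiliary matrix 𝔅(r) = B(r)(B(r)ᵀB(r))⁻¹B(r)ᵀ. -/
noncomputable def frakB (l : ℝ) (r : EuclideanSpace ℝ (Fin 2)) : Matrix (Fin 3) (Fin 3) ℝ :=
  Bmat l r * ((Bmat l r)ᵀ * Bmat l r)⁻¹ * (Bmat l r)ᵀ

lemma zc_pos {l : ℝ} {r : EuclideanSpace ℝ (Fin 2)} (hr : ‖r‖ < l) : 0 < zc l r :=
  Real.sqrt_pos.2 (sub_pos.2 (pow_lt_pow_left₀ hr (norm_nonneg r) two_ne_zero))

lemma zc_sq_add_sq_add_sq {l : ℝ} {r : EuclideanSpace ℝ (Fin 2)} (hr : ‖r‖ ≤ l) :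
    zc l r ^ 2 + r 0 ^ 2 + r 1 ^ 2 = l ^ 2 := by
  have h : ‖r‖ ^ 2 = r 0 ^ 2 + r 1 ^ 2 := by
    simp [EuclideanSpace.real_norm_sq_eq, Fin.sum_univ_two]
  rw [zc, Real.sq_sqrt (sub_nonneg.2 (pow_le_pow_left₀ (norm_nonneg r) hr 2)), h]
  ring

lemma cableVec_dotProduct_self {l : ℝ} {r : EuclideanSpace ℝ (Fin 2)} (hr : ‖r‖ ≤ l) :
    cableVec l r ⬝ᵥ cableVec l r = l ^ 2 := by
  rw [← zc_sq_add_sq_add_sq hr]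
  simp [cableVec, dotProduct, Fin.sum_univ_three]
  ring

lemma inv_Bmat_transpose_mul_Bmat {l : ℝ} {r : EuclideanSpace ℝ (Fin 2)} (hl : 0 < l)
    (hr : ‖r‖ < l) :
    ((Bmat l r)ᵀ * Bmat l r)⁻¹ =
      !![1 - r 0 ^ 2 / l ^ 2, -(r 0 * r 1) / l ^ 2;
        -(r 0 * r 1) / l ^ 2, 1 - r 1 ^ 2 / l ^ 2] := by
  have hz := (zc_pos hr).ne'
  have h := zc_sq_add_sq_add_sq hr.le
  apply inv_eq_right_inv
  ext i j
  fin_cases i <;> fin_cases j <;>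
    simp [Bmat, mul_apply, Fin.sum_univ_succ] <;> field_simp <;> (try rw [← h]) <;> ring

/-- 𝔅(r) is the orthogonal projection onto the plane perpendicular to the cable. -/
lemma frakB_eq_one_sub {l : ℝ} {r : EuclideanSpace ℝ (Fin 2)} (hl : 0 < l) (hr : ‖r‖ < l) :
    frakB l r = 1 - (l ^ 2)⁻¹ • vecMulVec (cableVec l r) (cableVec l r) := by
  have hz := (zc_pos hr).ne'
  have h := zc_sq_add_sq_add_sq hr.le
  rw [frakB, inv_Bmat_transpose_mul_Bmat hl hr]
  ext i j
  fin_cases i <;> fin_cases j <;>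
    simp [Bmat, cableVec, mul_apply, Fin.sum_univ_succ] <;>
    field_simp <;> (try rw [← h]) <;> ring

/-- For every x ∈ ℝ³, with x_∥ = (ℓ(r)ℓ(r)ᵀ/l²)x and x_⊥ = x − x_∥, one has
xᵀ 𝔅(r) x = x_⊥ᵀ x_⊥. -/
theorem stmt5 (l : ℝ) (hl : 0 < l) (r : EuclideanSpace ℝ (Fin 2)) (hr : ‖r‖ < l)
    (x : Fin 3 → ℝ) :
    x ⬝ᵥ (frakB l r).mulVec x =
      (x - ((l ^ 2)⁻¹ • Matrix.vecMulVec (cableVec l r) (cableVec l r)).mulVec x) ⬝ᵥ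
        (x - ((l ^ 2)⁻¹ • Matrix.vecMulVec (cableVec l r) (cableVec l r)).mulVec x) := by
  have hdot : cableVec l r ⬝ᵥ cableVec l r = l ^ 2 := cableVec_dotProduct_self hr.le
  have hl2 : l ^ 2 ≠ 0 := by positivity
  rw [frakB_eq_one_sub hl hr, sub_mulVec, one_mulVec]
  simp only [smul_mulVec, vecMulVec_mulVec, dotProduct_sub, sub_dotProduct, dotProduct_smul,
    smul_dotProduct, hdot, dotProduct_comm (cableVec l r) x, smul_eq_mul,
    op_smul_eq_smul]
  field_simp
  ring
end

section
/- Under the hypotheses and error dynamics of the UDE Lyapunov computation (N ≥ 1; c_T, λ_T, c_j, κ_j > 0; ‖ℓ_j(t)‖ = l; δ̃_T′ = −λ_T(δ̃_T + Σ_j δ̃_⊥,j); δ̃_j′ = −κ_j 𝔅_j δ̃_⊥,j), the derivative of V_e(t) = (1/2) c_T ‖δ̃_T(t)‖² + (1/2) Σ_{j=1}^{N} (c_T λ_T N/(2κ_j) + c_j/N) ‖δ̃_j(t)‖² satisfies V_e′(t) ≤ 0 for all t; consequently V_e is nonincreasing, and for all t ≥ 0 one has ‖δ̃_T(t)‖²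 ≤ (2/c_T) V_e(0) and ‖δ̃_j(t)‖² ≤ 2 V_e(0)/(c_T λ_T N/(2κ_j) + c_j/N), so all disturbance estimation errors are bounded. -/
open scoped RealInnerProductSpace

/-- The component of `v` perpendicular to `u` (with ‖u‖ = l):
v_⊥ = v − (uᵀv/l²) u. -/
noncomputable def perpC (l : ℝ) (u v : EuclideanSpace ℝ (Fin 3)) :
    EuclideanSpace ℝ (Fin 3) :=
  v - (⟪u, v⟫ / l ^ 2) • u

/-- The UDE Lyapunov function
V_e(t) = (1/2) c_T ‖δ̃_T(t)‖² + (1/2) Σ_j (c_T λ_T N/(2κ_j) + c_j/N) ‖δ̃_j(t)‖². -/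
noncomputable def Ve (N : ℕ) (cT lamT : ℝ) (c κ : Fin N → ℝ)
    (δT : ℝ → EuclideanSpace ℝ (Fin 3)) (δ : Fin N → ℝ → EuclideanSpace ℝ (Fin 3))
    (s : ℝ) : ℝ :=
  (1 / 2) * cT * ‖δT s‖ ^ 2 +
    (1 / 2) * ∑ j, (cT * lamT * N / (2 * κ j) + c j / N) * ‖δ j s‖ ^ 2

theorem inner_perpC_right {l : ℝ} (hl : 0 < l) {u : EuclideanSpace ℝ (Fin 3)} (hu : ‖u‖ = l)
    (v : EuclideanSpace ℝ (Fin 3)) : ⟪u, perpC l u v⟫ = 0 := by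
  rw [perpC, inner_sub_right, real_inner_smul_right, real_inner_self_eq_norm_sq, hu]
  field_simp
  ring

theorem perpC_perpC {l : ℝ} (hl : 0 < l) {u : EuclideanSpace ℝ (Fin 3)} (hu : ‖u‖ = l)
    (v : EuclideanSpace ℝ (Fin 3)) : perpC l u (perpC l u v) = perpC l u v := by
  conv_lhs => rw [perpC, inner_perpC_right hl hu]
  simp

theorem inner_self_perpC {l : ℝ} (hl : 0 < l) {u : EuclideanSpace ℝ (Fin 3)} (hu : ‖u‖ = l)
    (v : EuclideanSpace ℝ (Fin 3)) : ⟪v, perpC l u v⟫ = ‖perpC l u v‖ ^ 2 := by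
  have hv : v = perpC l u v + (⟪u, v⟫ / l ^ 2) • u := by simp [perpC]
  calc ⟪v, perpC l u v⟫
      = ⟪perpC l u v + (⟪u, v⟫ / l ^ 2) • u, perpC l u v⟫ := by rw [← hv]
    _ = ‖perpC l u v‖ ^ 2 := by
      rw [inner_add_left, real_inner_smul_left, inner_perpC_right hl hu,
        real_inner_self_eq_norm_sq, mul_zero, add_zero]

theorem norm_sum_sq_le_card_mul_sum_norm_sq {E ι : Type*} [SeminormedAddCommGroup E]
    (s : Finset ι) (p : ι → E) : ‖∑ j ∈ s, p j‖ ^ 2 ≤ s.card * ∑ j ∈ s, ‖p j‖ ^ 2 :=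
  (pow_le_pow_left₀ (norm_nonneg _) (norm_sum_le s p) 2).trans sq_sum_le_card_mul_sum_sq

theorem neg_norm_sq_sub_inner_sum_le {E ι : Type*} [NormedAddCommGroup E]
    [InnerProductSpace ℝ E] (s : Finset ι) (x : E) (p : ι → E) :
    -(‖x‖ ^ 2 + ⟪x, ∑ j ∈ s, p j⟫) ≤ s.card / 2 * ∑ j ∈ s, ‖p j‖ ^ 2 := by
  have h := norm_sum_sq_le_card_mul_sum_norm_sq s p
  have h' := norm_add_sq_real x (∑ j ∈ s, p j)
  linarith [sq_nonneg ‖x + ∑ j ∈ s, p j‖, sq_nonneg ‖x‖]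

/-- Along the UDE estimation-error dynamics, V_e′ ≤ 0, V_e is nonincreasing, and all
disturbance estimation errors are bounded in terms of V_e(0). -/
theorem stmt11 (N : ℕ) (hN : 1 ≤ N) (cT lamT : ℝ) (hcT : 0 < cT) (hlamT : 0 < lamT)
    (c κ : Fin N → ℝ) (hc : ∀ j, 0 < c j) (hκ : ∀ j, 0 < κ j) (l : ℝ) (hl : 0 < l)
    (ℓ : Fin N → ℝ → EuclideanSpace ℝ (Fin 3)) (hℓ : ∀ j t, ‖ℓ j t‖ = l)
    (δT : ℝ → EuclideanSpace ℝ (Fin 3)) (δ : Fin N → ℝ → EuclideanSpace ℝ (Fin 3))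
    (hδT : ∀ t, HasDerivAt δT (-lamT • (δT t + ∑ j, perpC l (ℓ j t) (δ j t))) t)
    (hδ : ∀ j t, HasDerivAt (δ j)
      (-κ j • perpC l (ℓ j t) (perpC l (ℓ j t) (δ j t))) t) :
    (∀ t, deriv (Ve N cT lamT c κ δT δ) t ≤ 0) ∧
      Antitone (Ve N cT lamT c κ δT δ) ∧
      ∀ t, 0 ≤ t →
        ‖δT t‖ ^ 2 ≤ (2 / cT) * Ve N cT lamT c κ δT δ 0 ∧
        ∀ j, ‖δ j t‖ ^ 2 ≤
          2 * Ve N cT lamT c κ δT δ 0 / (cT * lamT * N / (2 * κ j) + c j / N) := by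
  have hNpos : (0 : ℝ) < N := by exact_mod_cast hN
  have hw : ∀ j, 0 < cT * lamT * N / (2 * κ j) + c j / N := fun j => by
    have := hc j
    have := hκ j
    positivity
  have hder : ∀ t, HasDerivAt (Ve N cT lamT c κ δT δ)
      (-(cT * lamT) * (‖δT t‖ ^ 2 + ⟪δT t, ∑ j, perpC l (ℓ j t) (δ j t)⟫) -
        ∑ j, (cT * lamT * N / 2 + c j * κ j / N) * ‖perpC l (ℓ j t) (δ j t)‖ ^ 2) t := by
    intro t
    have hT := (hδT t).norm_sq.const_mul ((1 / 2) * cT)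
    have hS := (HasDerivAt.fun_sum (u := Finset.univ) fun j _ =>
      (hδ j t).norm_sq.const_mul (cT * lamT * N / (2 * κ j) + c j / N)).const_mul (1 / 2)
    refine (hT.add hS).congr_deriv ?_
    rw [sub_eq_add_neg, ← Finset.sum_neg_distrib, Finset.mul_sum]
    congr 1
    · rw [real_inner_smul_right, inner_add_right, real_inner_self_eq_norm_sq]
      ring
    · refine Finset.sum_congr rfl fun j _ => ?_
      rw [perpC_perpC hl (hℓ j t), real_inner_smul_right, inner_self_perpC hl (hℓ j t)]
      have := (hκ j).ne'
      field_simp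
  have hle : ∀ t, deriv (Ve N cT lamT c κ δT δ) t ≤ 0 := by
    intro t
    rw [(hder t).deriv]
    have h := mul_le_mul_of_nonneg_left
      (neg_norm_sq_sub_inner_sum_le Finset.univ (δT t) fun j => perpC l (ℓ j t) (δ j t))
      (mul_pos hcT hlamT).le
    have hnn : 0 ≤ ∑ j, c j * κ j / N * ‖perpC l (ℓ j t) (δ j t)‖ ^ 2 :=
      Finset.sum_nonneg fun j _ => by
        have := hc j
        have := hκ j
        positivity
    simp only [add_mul, Finset.sum_add_distrib, ← Finset.mul_sum]
    rw [Finset.card_univ, Fintype.card_fin] at h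
    linarith
  have hanti : Antitone (Ve N cT lamT c κ δT δ) :=
    antitone_of_deriv_nonpos (fun t => (hder t).differentiableAt) hle
  refine ⟨hle, hanti, fun t ht => ?_⟩
  have hV := hanti ht
  have hterm : ∀ j, 0 ≤ (cT * lamT * N / (2 * κ j) + c j / N) * ‖δ j t‖ ^ 2 :=
    fun j => mul_nonneg (hw j).le (sq_nonneg _)
  have hVt : Ve N cT lamT c κ δT δ t = (1 / 2) * cT * ‖δT t‖ ^ 2 +
    (1 / 2) * ∑ j, (cT * lamT * N / (2 * κ j) + c j / N) * ‖δ j t‖ ^ 2 := rfl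
  refine ⟨?_, fun j => ?_⟩
  · have := Finset.sum_nonneg fun j (_ : j ∈ Finset.univ) => hterm j
    rw [div_mul_eq_mul_div, le_div_iff₀ hcT]
    linarith
  · have := Finset.single_le_sum (fun j _ => hterm j) (Finset.mem_univ j)
    have := mul_nonneg hcT.le (sq_nonneg ‖δT t‖)
    rw [le_div_iff₀ (hw j)]
    linarith
end
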